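/- There is no tile assembly system in the abstract Tile Assembly Model that strictly self-assembles the H fractal 𝐇. That is, for every aTAM tile assembly system 𝒯 = (T, σ, τ), it is not the case that every producible terminal assembly of 𝒯 has domain exactly 𝐇. -/

import Mathlib

/-- A point of the integer lattice `ℤ²`. -/
abbrev Pt := ℤ × ℤ

/-- The generator of the H fractal. -/
def GH : Set Pt := {(0,0),(0,1),(0,2),(1,1),(2,0),(2,1),(2,2)}

/-- `scaleAdd k A B = A + k·B` (componentwise). -/
def scaleAdd (k : ℤ) (A B : Set Pt) : Set Pt :=
  {q | ∃ p ∈ A, ∃ g ∈ B, q = (p.1 + k * g.1, p.2 + k * g.2)}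

/-- The stages of the H fractal: `hstage 1 = GH` and
`hstage (i+1) = hstage i + 3^i · GH` for `i ≥ 1`. -/
def hstage : ℕ → Set Pt
  | 0 => ∅
  | 1 => GH
  | n + 2 => scaleAdd (3 ^ (n + 1)) (hstage (n + 1)) GH

/-- The H fractal `𝐇 = ⋃_{i ≥ 1} h_i`. -/
def HFractal : Set Pt := {p | ∃ i : ℕ, 1 ≤ i ∧ p ∈ hstage i}

/-- A tile type: a glue (label, drawn from `ℕ`) on each of its four sides.
The strength of a glue label is given by a strength function. -/
structure TileType where
  north : ℕ
  east : ℕ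
  south : ℕ
  west : ℕ
deriving DecidableEq

/-- An assembly: a partial function from `ℤ²` to tile types. -/
abbrev Assembly := Pt → Option TileType

/-- The domain of an assembly. -/
def adom (α : Assembly) : Set Pt := {p | α p ≠ none}

/-- The strength of the bond between the tiles of `α` at positions `p` and `q`
(zero unless `q` is adjacent to `p`, both are tiled, and the abutting glues match). -/
def bond (s : ℕ → ℕ) (α : Assembly) (p q : Pt) : ℕ :=
  match α p, α q with
  | some t, some t' =>
      if q = (p.1 + 1, p.2) then (if t.east = t'.west then s t.east else 0)
      else if q = (p.1 - 1, p.2) then (if t.west = t'.east then s t.west else 0)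
      else if q = (p.1, p.2 + 1) then (if t.north = t'.south then s t.north else 0)
      else if q = (p.1, p.2 - 1) then (if t.south = t'.north then s t.south else 0)
      else 0
  | _, _ => 0

/-- `α` is `τ`-stable: every cut of its binding graph has total glue strength at
least `τ` (witnessed by finitely many bonds crossing the cut). -/
def IsStable (s : ℕ → ℕ) (τ : ℕ) (α : Assembly) : Prop :=
  ∀ A B : Set Pt, A ∪ B = adom α → Disjoint A B → A.Nonempty → B.Nonempty →
    ∃ F : Finset (Pt × Pt), (∀ e ∈ F, e.1 ∈ A ∧ e.2 ∈ B) ∧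
      τ ≤ ∑ e ∈ F, bond s α e.1 e.2

/-- The total strength with which a tile of type `t` placed at the empty position `p`
would bind to its already-placed neighbors in `α`. -/
def attachStrength (s : ℕ → ℕ) (α : Assembly) (p : Pt) (t : TileType) : ℕ :=
  (match α (p.1 + 1, p.2) with
    | some t' => if t.east = t'.west then s t.east else 0
    | none => 0) +
  (match α (p.1 - 1, p.2) with
    | some t' => if t.west = t'.east then s t.west else 0
    | none => 0) +
  (match α (p.1, p.2 + 1) with
    | some t' => if t.north = t'.south then s t.north else 0
    | none => 0) +
  (match α (p.1, p.2 - 1) with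
    | some t' => if t.south = t'.north then s t.south else 0
    | none => 0)

/-- An aTAM tile assembly system `𝒯 = (T, σ, τ)`: a glue strength function, a finite
tile set, a finite `τ`-stable seed assembly, and a temperature `τ`. -/
structure TAS where
  strength : ℕ → ℕ
  tiles : Finset TileType
  seed : Assembly
  temp : ℕ
  seed_finite : (adom seed).Finite
  seed_tiles : ∀ p t, seed p = some t → t ∈ tiles
  seed_stable : IsStable strength temp seed

/-- A single-tile attachment step: a tile of the system attaches at an empty
position with total binding strength at least the temperature. -/
def Step (S : TAS) (α β : Assembly) : Prop :=
  ∃ p t, t ∈ S.tiles ∧ α p = none ∧ S.temp ≤ attachStrength S.strength α p t ∧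
    β = Function.update α p (some t)

/-- `β` is the result of a (finite or infinite) sequence of single-tile attachment
steps starting from `α`. -/
def ReachesFrom (S : TAS) (α β : Assembly) : Prop :=
  ∃ c : ℕ → Assembly, c 0 = α ∧ (∀ n, c (n + 1) = c n ∨ Step S (c n) (c (n + 1))) ∧
    (∀ p n t, c n p = some t → β p = some t) ∧
    (∀ p t, β p = some t → ∃ n, c n p = some t)

/-- A producible assembly: the result of a (finite or infinite) sequence of
single-tile attachment steps starting from the seed. -/
def Producible (S : TAS) (α : Assembly) : Prop := ReachesFrom S S.seed α

/-- A terminal assembly: no tile can attach to it. -/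
def Terminal (S : TAS) (α : Assembly) : Prop := ∀ β, ¬ Step S α β

/-- `S` finitely self-assembles `X` if every finite producible assembly of `S` can be
extended, by a (finite or infinite) sequence of single-tile attachment steps, to an
assembly whose domain is exactly `X`. -/
def FinitelySelfAssembles (S : TAS) (X : Set Pt) : Prop :=
  ∀ α, Producible S α → (adom α).Finite →
    ∃ β, ReachesFrom S α β ∧ adom β = X

/-- `S` strictly self-assembles `X` if every producible terminal assembly of `S`
has domain exactly `X`. -/
def StrictlySelfAssembles (S : TAS) (X : Set Pt) : Prop :=
  ∀ α, Producible S α → Terminal S α → adom α = X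

/-- Repunit in base three: `11…1` (`n` digits). -/
def rep : ℕ → ℤ
  | 0 => 0
  | n + 1 => 3 * rep n + 1

/-- The `i`-th ternary digit of `a`. -/
def dg (a : ℤ) (i : ℕ) : ℤ := a / 3 ^ i % 3

lemma p3 (n : ℕ) : (0 : ℤ) < 3 ^ n := by positivity

lemma rep_two (n : ℕ) : 2 * rep n + 1 = 3 ^ n := by
  induction n with
  | zero => simp [rep]
  | succ n ih => rw [rep, pow_succ]; omega

lemma rep_top (n : ℕ) : rep (n + 1) = 3 ^ n + rep n := by
  have := rep_two n
  rw [rep]; omega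

lemma rep_nonneg (n : ℕ) : 0 ≤ rep n := by
  have := rep_two n
  have := p3 n
  omega

lemma rep_lt (n : ℕ) : rep n < 3 ^ n := by
  have := rep_two n
  have := rep_nonneg n
  omega

lemma rep_split (a b : ℕ) : rep (a + b) = 3 ^ a * rep b + rep a := by
  induction a with
  | zero => simp [rep]
  | succ a ih =>
    rw [show a + 1 + b = (a + b) + 1 by ring, rep, ih, rep, pow_succ]; ring

lemma div_split (k : ℕ) (q r : ℤ) (h0 : 0 ≤ r) (h1 : r < 3 ^ k) :
    (3 ^ k * q + r) / 3 ^ k = q := by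
  rw [Int.mul_add_ediv_left _ _ (p3 k).ne', Int.ediv_eq_zero_of_lt h0 h1, add_zero]

lemma div_succ (a : ℤ) (k : ℕ) : a / 3 ^ (k + 1) = a / 3 ^ k / 3 := by
  rw [pow_succ, Int.ediv_ediv_of_nonneg (p3 k).le]

lemma dg_zero_pow (i : ℕ) : dg 0 i = 0 := by simp [dg]

/-- digits below `k` are not changed by adding a multiple of `3^k`. -/
lemma dg_add_mul (a q : ℤ) (i k : ℕ) (h : i < k) : dg (a + 3 ^ k * q) i = dg a i := by
  obtain ⟨d, rfl⟩ := Nat.exists_eq_add_of_lt h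
  unfold dg
  rw [show (a + 3 ^ (i + d + 1) * q : ℤ) = a + 3 ^ i * (3 ^ d * q * 3) by ring,
    Int.add_mul_ediv_left _ _ (p3 i).ne', Int.add_mul_emod_self_right]

/-- all low digits one. -/
lemma mod_of_digits (y : ℤ) (k : ℕ) (h : ∀ i < k, dg y i = 1) :
    y = 3 ^ k * (y / 3 ^ k) + rep k := by
  induction k with
  | zero => simp [rep]
  | succ k ih =>
    have h1 := ih (fun i hi => h i (by omega))
    have h2 := h k (by omega)
    unfold dg at h2
    rw [div_succ, rep_top, pow_succ]
    have h3 : y / 3 ^ k = 3 * (y / 3 ^ k / 3) + 1 := by omega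
    calc y = 3 ^ k * (y / 3 ^ k) + rep k := h1
      _ = 3 ^ k * (3 * (y / 3 ^ k / 3) + 1) + rep k := by rw [← h3]
      _ = _ := by ring

lemma digits_of_mod (q : ℤ) (k i : ℕ) (h : i < k) : dg (3 ^ k * q + rep k) i = 1 := by
  rw [add_comm, dg_add_mul _ _ _ _ h]
  obtain ⟨d, rfl⟩ := Nat.exists_eq_add_of_lt h
  unfold dg
  rw [show i + d + 1 = i + (d + 1) by ring, rep_split, div_split _ _ _ (rep_nonneg i) (rep_lt i), rep]
  omega

/-- necessary condition for membership. -/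
def Good (z : Pt) : Prop := 0 ≤ z.1 ∧ 0 ≤ z.2 ∧ ∀ i, dg z.1 i = 1 → dg z.2 i = 1

lemma dg_big (a : ℤ) (n i : ℕ) (g : ℤ) (h0 : 0 ≤ a) (h1 : a < 3 ^ n) (hg0 : 0 ≤ g) (hg : g < 3) :
    dg (a + 3 ^ n * g) i = if i < n then dg a i else if i = n then g else 0 := by
  split_ifs with h h'
  · exact dg_add_mul _ _ _ _ h
  · subst h'
    unfold dg
    rw [add_comm, div_split _ _ _ h0 h1]; omega
  · obtain ⟨d, rfl⟩ := Nat.exists_eq_add_of_lt (show n < i by omega)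
    unfold dg
    rw [Int.ediv_eq_zero_of_lt]
    · rfl
    · have := p3 n; positivity
    · have h2 : (3 : ℤ) ^ (n + d + 1) = 3 ^ n * 3 ^ d * 3 := by ring
      have h3 : (1 : ℤ) ≤ 3 ^ d := by have := p3 d; omega
      have := p3 n
      rw [h2]; nlinarith

lemma GH_bd {g : Pt} (h : g ∈ GH) :
    0 ≤ g.1 ∧ g.1 < 3 ∧ 0 ≤ g.2 ∧ g.2 < 3 ∧ (g.1 = 1 → g.2 = 1) := by
  simp only [GH, Set.mem_insert_iff, Set.mem_singleton_iff] at h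
  rcases h with h | h | h | h | h | h | h <;> subst h <;> simp

lemma hstage_good (n : ℕ) : ∀ z ∈ hstage (n + 1),
    z.1 < 3 ^ (n + 1) ∧ z.2 < 3 ^ (n + 1) ∧ Good z := by
  induction n with
  | zero =>
    intro g hg
    have h := GH_bd (g := g) (by simpa [hstage] using hg)
    refine ⟨by simpa using h.2.1, by simpa using h.2.2.2.1, h.1, h.2.2.1, ?_⟩
    intro i
    have e1 := dg_big 0 0 i g.1 le_rfl (by simp) h.1 h.2.1
    have e2 := dg_big 0 0 i g.2 le_rfl (by simp) h.2.2.1 h.2.2.2.1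
    simp only [pow_zero, one_mul, zero_add] at e1 e2
    rw [e1, e2]
    simp only [not_lt_zero, if_false]
    split_ifs
    · exact h.2.2.2.2
    · simp
  | succ n ih =>
    rintro z ⟨p, hp, g, hg, rfl⟩
    obtain ⟨b1, b2, g1, g2, g3⟩ := ih p hp
    obtain ⟨h1, h2, h3, h4, h5⟩ := GH_bd hg
    have hp3 := p3 (n + 1)
    refine ⟨?_, ?_, ?_, ?_, ?_⟩
    · simp only []; rw [pow_succ _ (n + 1)]; nlinarith
    · simp only []; rw [pow_succ _ (n + 1)]; nlinarith
    · simp only []; positivity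
    · simp only []; positivity
    · intro i
      simp only []
      rw [dg_big _ _ _ _ g1 b1 h1 h2, dg_big _ _ _ _ g2 b2 h3 h4]
      split_ifs
      · exact g3 i
      · exact h5
      · simp

lemma H_good {z : Pt} (h : z ∈ HFractal) : Good z := by
  obtain ⟨i, hi, h⟩ := h
  obtain ⟨n, rfl⟩ : ∃ n, i = n + 1 := ⟨i - 1, by omega⟩
  exact (hstage_good n z h).2.2

lemma zero_mem_hstage (n : ℕ) : ((0, 0) : Pt) ∈ hstage (n + 1) := by
  induction n with
  | zero => simp [hstage, GH]
  | succ n ih => exact ⟨(0, 0), ih, (0, 0), by simp [GH], by simp⟩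

lemma far_mem (j : ℕ) : ((2 * 3 ^ (j + 1), 0) : Pt) ∈ HFractal :=
  ⟨j + 2, by omega, (0, 0), zero_mem_hstage j, (2, 0), by simp [GH], by simp; ring⟩

/-! Number lemmas for the shift. -/

/-- carry lemma -/
lemma carry (j e : ℕ) (u : ℤ) : ∀ t, t ≤ e →
    (∀ i < j + t, dg u i ≠ 1 ∧ dg (u + 3 ^ j * rep e) i ≠ 1) →
    (u + 3 ^ j * rep e) / 3 ^ (j + t) = u / 3 ^ (j + t) + rep (e - t) + ((t % 2 : ℕ) : ℤ) := by
  intro t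
  induction t with
  | zero =>
    intro _ _
    simp [Int.add_mul_ediv_left _ _ (p3 j).ne']
  | succ t ih =>
    intro ht h
    have h1 := ih (by omega) (fun i hi => h i (by omega))
    obtain ⟨h2, h3⟩ := h (j + t) (by omega)
    unfold dg at h2 h3
    rw [← add_assoc, div_succ, div_succ]
    obtain ⟨d, hd⟩ : ∃ d, e - t = d + 1 := ⟨e - t - 1, by omega⟩
    rw [show e - (t + 1) = d by omega]
    rw [hd, rep] at h1
    have h4 := Nat.mod_two_eq_zero_or_one t
    rcases h4 with h4 | h4
    · rw [show (t + 1) % 2 = 1 by omega]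
      rw [h4] at h1
      push_cast at *
      omega
    · rw [show (t + 1) % 2 = 0 by omega]
      rw [h4] at h1
      push_cast at *
      omega

/-- vertical lemma -/
lemma vert_up (y : ℤ) (M i : ℕ) (hi : i < M) (h2 : dg (y + 1) i = 1) :
    (y + 1) / 3 ^ M = y / 3 ^ M := by
  have hp := p3 M
  have e1 := Int.mul_ediv_add_emod (y + 1) (3 ^ M)
  have n1 := Int.emod_nonneg (y + 1) hp.ne'
  have l1 := Int.emod_lt_of_pos (y + 1) hp
  by_cases h0 : (y + 1) % 3 ^ M = 0
  · exfalso
    have : dg (0 + 3 ^ M * ((y + 1) / 3 ^ M)) i = dg 0 i := dg_add_mul _ _ _ _ hi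
    rw [show 0 + 3 ^ M * ((y + 1) / 3 ^ M) = y + 1 by omega, h2, dg_zero_pow] at this
    omega
  · have : y = 3 ^ M * ((y + 1) / 3 ^ M) + ((y + 1) % 3 ^ M - 1) := by omega
    conv_rhs => rw [this]
    rw [div_split]
    · omega
    · omega

lemma vert (y y' : ℤ) (M i : ℕ) (hi : i < M) (h1 : dg y i = 1) (h2 : dg y' i = 1)
    (h : y' = y + 1 ∨ y' = y - 1) : y' / 3 ^ M = y / 3 ^ M := by
  rcases h with rfl | rfl
  · exact vert_up y M i hi h2
  · have := vert_up (y - 1) M i hi (by simpa using h1)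
    simpa using this.symm

/-- four-neighbour adjacency -/
def Nb (z q : Pt) : Prop :=
  q = (z.1 + 1, z.2) ∨ q = (z.1 - 1, z.2) ∨ q = (z.1, z.2 + 1) ∨ q = (z.1, z.2 - 1)

lemma factB (y κ : ℤ) (M : ℕ) (hκ : κ % 3 ≠ 0) (h1 : dg y M = 1)
    (h2 : dg (y + 3 ^ M * κ) M = 1) : False := by
  unfold dg at *
  rw [Int.add_mul_ediv_left _ _ (p3 M).ne'] at h2
  omega

/-- Both the point and its shift satisfy the digit condition. -/
def Both (j m e : ℕ) (κ : ℤ) (z : Pt) : Prop :=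
  Good z ∧ Good (z.1 - 3 ^ (j + 1) * rep e, z.2 + 3 ^ (j + 1 + m) * κ)

/-- The invariant region. -/
def KReg (j m e : ℕ) (κ : ℤ) (z : Pt) : Prop :=
  (m % 2 = 0 → z.1 - 3 ^ (j + 1) * rep e < 3 ^ (j + 1 + m) ∧ dg z.2 (j + 1 + m) = 1) ∧
  (m % 2 = 1 → z.1 - 3 ^ (j + 1) * rep e < 3 ^ (j + 1 + m + 1) ∧
    (3 ^ (j + 1 + m) ≤ z.1 - 3 ^ (j + 1) * rep e →
      dg (z.2 + 3 ^ (j + 1 + m) * κ) (j + 1 + m) = 1))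

lemma both_digit {j m e : ℕ} {κ : ℤ} {z : Pt} (h : Both j m e κ z) (i : ℕ) (hi : i < j + 1 + m)
    (h1 : dg (z.1 - 3 ^ (j + 1) * rep e) i = 1 ∨ dg z.1 i = 1) : dg z.2 i = 1 := by
  rcases h1 with h1 | h1
  · have := h.2.2.2 i h1
    simp only [] at this
    rwa [dg_add_mul _ _ _ _ hi] at this
  · exact h.1.2.2 i h1

/-- in a column without low ones the digit at position `M` of the two abscissae are related. -/
lemma free_col {j m e : ℕ} (he : m + 3 ≤ e) (x : ℤ)
    (h : ∀ i < j + 1 + m, ¬ (dg (x - 3 ^ (j + 1) * rep e) i = 1 ∨ dg x i = 1)) :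
    dg x (j + 1 + m) =
      ((x - 3 ^ (j + 1) * rep e) / 3 ^ (j + 1 + m) + 1 + ((m % 2 : ℕ) : ℤ)) % 3 := by
  have := carry (j + 1) e (x - 3 ^ (j + 1) * rep e) m (by omega) (by
    intro i hi
    have := h i hi
    push Not at this
    simpa using this)
  rw [sub_add_cancel] at this
  unfold dg
  rw [this]
  obtain ⟨d, hd⟩ : ∃ d, e - m = d + 1 := ⟨e - m - 1, by omega⟩
  rw [hd, rep]
  omega

lemma pow_dg (M : ℕ) (x : ℤ) (h : x = 3 ^ M) : dg x M = 1 := by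
  subst h
  unfold dg
  rw [Int.ediv_self (p3 M).ne']; rfl

lemma K_step {j m e : ℕ} {κ : ℤ} (he : m + 3 ≤ e) (hκ : κ % 3 ≠ 0) {z q : Pt}
    (hz : Both j m e κ z) (hq : Both j m e κ q) (hK : KReg j m e κ q) (hnb : Nb z q) :
    KReg j m e κ z := by
  obtain ⟨x, y⟩ := z
  obtain ⟨x', y'⟩ := q
  have hnb' : (y' = y ∧ (x' = x + 1 ∨ x' = x - 1)) ∨ (x' = x ∧ (y' = y + 1 ∨ y' = y - 1)) := by
    simp only [Nb, Prod.mk.injEq] at hnb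
    tauto
  clear hnb
  have hu0 : 0 ≤ x - 3 ^ (j + 1) * rep e := hz.2.1
  have hu0' : 0 ≤ x' - 3 ^ (j + 1) * rep e := hq.2.1
  have hpM := p3 (j + 1 + m)
  have hpow : (3 : ℤ) ^ (j + 1 + m + 1) = 3 * 3 ^ (j + 1 + m) := by ring
  obtain ⟨hK0, hK1⟩ := hK
  simp only [KReg] at *
  constructor
  · intro hm
    obtain ⟨ha, hb⟩ := hK0 hm
    rcases hnb' with ⟨rfl, hx⟩ | ⟨rfl, hy⟩
    · refine ⟨?_, hb⟩
      by_contra hcon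
      have hx3 : x - 3 ^ (j + 1) * rep e = 3 ^ (j + 1 + m) := by omega
      exact factB y' κ _ hκ hb (hz.2.2.2 _ (pow_dg _ _ hx3))
    · refine ⟨ha, ?_⟩
      by_cases hf : ∃ i < j + 1 + m, (dg (x' - 3 ^ (j + 1) * rep e) i = 1 ∨ dg x' i = 1)
      · obtain ⟨i, hi, hf⟩ := hf
        have h1 := both_digit hz i hi hf
        have h2 := both_digit hq i hi hf
        have := vert _ _ _ i hi h1 h2 hy
        unfold dg at hb ⊢
        rw [← this]; exact hb
      · push Not at hf
        have := free_col (j := j) he x' (by intro i hi; have := hf i hi; tauto)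
        rw [Int.ediv_eq_zero_of_lt hu0 ha, hm] at this
        exact hz.1.2.2 _ (by simpa using this)
  · intro hm
    obtain ⟨ha, hb⟩ := hK1 hm
    rcases hnb' with ⟨rfl, hx⟩ | ⟨rfl, hy⟩
    · constructor
      · by_contra hcon
        have hx3 : x = 3 ^ (j + 1 + m + 1) + 3 ^ (j + 1) * rep e := by omega
        have hx4 : dg x (j + 1 + m) = 1 := by
          obtain ⟨d, rfl⟩ : ∃ d, e = m + (d + 1) := ⟨e - m - 1, by omega⟩
          rw [hx3, rep_split m, rep]
          have : (3 : ℤ) ^ (j + 1 + m + 1) + 3 ^ (j + 1) * (3 ^ m * (3 * rep d + 1) + rep m)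
            = 3 ^ (j + 1 + m) * (3 * (rep d + 1) + 1) + 3 ^ (j + 1) * rep m := by ring
          rw [this]
          unfold dg
          rw [div_split]
          · omega
          · have := rep_nonneg m; positivity
          · rw [pow_add _ (j + 1) m]
            exact mul_lt_mul_of_pos_left (rep_lt m) (p3 _)
        exact factB y' κ _ hκ (hz.1.2.2 _ hx4) (hb (by omega))
      · intro hge
        by_cases h2 : 2 * 3 ^ (j + 1 + m) ≤ x - 3 ^ (j + 1) * rep e
        · exact hb (by omega)
        · refine hz.2.2.2 _ ?_
          unfold dg
          simp only []
          rw [show x - 3 ^ (j + 1) * rep e = 3 ^ (j + 1 + m) * 1 +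
            (x - 3 ^ (j + 1) * rep e - 3 ^ (j + 1 + m)) by ring, div_split]
          · rfl
          · omega
          · omega
    · refine ⟨ha, fun hge => ?_⟩
      have hb := hb hge
      by_cases hf : ∃ i < j + 1 + m, (dg (x' - 3 ^ (j + 1) * rep e) i = 1 ∨ dg x' i = 1)
      · obtain ⟨i, hi, hf⟩ := hf
        have h1 := both_digit hz i hi hf
        have h2 := both_digit hq i hi hf
        have := vert _ _ _ i hi h1 h2 hy
        unfold dg at hb ⊢
        rw [Int.add_mul_ediv_left _ _ hpM.ne'] at hb ⊢
        rw [← this]; exact hb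
      · push Not at hf
        have := free_col (j := j) he x' (by intro i hi; have := hf i hi; tauto)
        by_cases h2 : 2 * 3 ^ (j + 1 + m) ≤ x' - 3 ^ (j + 1) * rep e
        · exfalso
          rw [show x' - 3 ^ (j + 1) * rep e = 3 ^ (j + 1 + m) * 2 +
            (x' - 3 ^ (j + 1) * rep e - 2 * 3 ^ (j + 1 + m)) by ring,
            div_split _ _ _ (by omega) (by omega), hm] at this
          exact factB y' κ _ hκ (hq.1.2.2 _ (by simpa using this)) hb
        · refine hz.2.2.2 _ ?_
          unfold dg
          simp only []
          rw [show x' - 3 ^ (j + 1) * rep e = 3 ^ (j + 1 + m) * 1 +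
            (x' - 3 ^ (j + 1) * rep e - 3 ^ (j + 1 + m)) by ring, div_split]
          · rfl
          · omega
          · omega

lemma K_bound {j m e : ℕ} {κ : ℤ} {z : Pt} (hK : KReg j m e κ z) :
    z.1 - 3 ^ (j + 1) * rep e < 3 ^ (j + 1 + m + 1) := by
  have hpM := p3 (j + 1 + m)
  have hpow : (3 : ℤ) ^ (j + 1 + m + 1) = 3 * 3 ^ (j + 1 + m) := by ring
  rcases Nat.mod_two_eq_zero_or_one m with h | h
  · have := (hK.1 h).1
    omega
  · exact (hK.2 h).1

/-- the target column is out of the region -/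
lemma K_far {j m e : ℕ} {κ : ℤ} (he : m + 3 ≤ e) {z : Pt} (hz : z.1 = 2 * 3 ^ (j + e)) :
    ¬ KReg j m e κ z := by
  intro hK
  have h := K_bound hK
  rw [hz] at h
  obtain ⟨d, rfl⟩ : ∃ d, e = m + 3 + d := ⟨e - m - 3, by omega⟩
  have h1 := rep_two (m + 3 + d)
  have h2 : (3 : ℤ) ^ (j + (m + 3 + d)) = 3 ^ j * 3 ^ (m + 3 + d) := by rw [pow_add]
  have h3 : (3 : ℤ) ^ (j + 1) * rep (m + 3 + d) = 3 ^ j * (3 * rep (m + 3 + d)) := by ring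
  have h4 : (3 : ℤ) ^ (j + 1 + m + 1) = 3 ^ j * (9 * 3 ^ m) := by ring
  have h5 : (3 : ℤ) ^ (m + 3 + d) = 27 * 3 ^ m * 3 ^ d := by ring
  have h6 : (1 : ℤ) ≤ 3 ^ d := by have := p3 d; omega
  have h7 := p3 m
  rw [h2, h3, h4, ← mul_assoc, mul_comm 2 ((3:ℤ)^j), mul_assoc, ← mul_sub] at h
  have h8 := lt_of_mul_lt_mul_left h (p3 j).le
  have h9 : 27 * 3 ^ m ≤ (3 : ℤ) ^ (m + 3 + d) := by rw [h5]; nlinarith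
  omega

/-- the starting point is in the region -/
lemma K_start {j m e : ℕ} {κ : ℤ} {z : Pt} (hx : z.1 = rep (j + 1 + e))
    (hy : dg z.2 (j + 1 + m) = 1) : KReg j m e κ z := by
  have h1 := rep_split (j + 1) e
  have h2 := rep_lt (j + 1)
  have h3 : (3 : ℤ) ^ (j + 1) ≤ 3 ^ (j + 1 + m) := pow_le_pow_right₀ (by norm_num) (by omega)
  have hpM := p3 (j + 1 + m)
  have hpow : (3 : ℤ) ^ (j + 1 + m + 1) = 3 * 3 ^ (j + 1 + m) := by ring
  refine ⟨fun _ => ⟨by omega, hy⟩, fun _ => ⟨by omega, fun _ => by omega⟩⟩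

/-! Geometry of the blocks. -/

/-- The part of a block of size `3^j` to the right of its centre, with the next column. -/
def DReg (j : ℕ) (b : ℤ) : Set Pt :=
  {z | z ∈ HFractal ∧ rep (j + 1) < z.1 ∧ z.1 ≤ 2 * 3 ^ j ∧ z.2 / 3 ^ j = b}

/-- The centre of a block. -/
def ctr (j : ℕ) (b : ℤ) : Pt := (rep (j + 1), 3 ^ j * b + rep j)

lemma ctr_digits (j : ℕ) (b : ℤ) (hb : b % 3 = 1) (i : ℕ) (hi : i ≤ j) :
    dg (3 ^ j * b + rep j) i = 1 := by
  have : 3 ^ j * b + rep j = 3 ^ (j + 1) * (b / 3) + rep (j + 1) := by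
    rw [rep_top, pow_succ]
    have : b = 3 * (b / 3) + 1 := by omega
    conv_lhs => rw [this]
    ring
  rw [this]
  exact digits_of_mod _ _ _ (by omega)

lemma near_div (y y' : ℤ) (j : ℕ) (h : y' = y + 1 ∨ y' = y - 1) :
    y' / 3 ^ j = y / 3 ^ j ∨ y' / 3 ^ j = y / 3 ^ j + 1 ∨ y' / 3 ^ j = y / 3 ^ j - 1 := by
  have hp := p3 j
  rcases h with rfl | rfl
  · have h1 : y / 3 ^ j ≤ (y + 1) / 3 ^ j := Int.ediv_le_ediv hp (by omega)
    have h2 : (y + 1) / 3 ^ j ≤ (y + 3 ^ j * 1) / 3 ^ j := Int.ediv_le_ediv hp (by omega)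
    rw [Int.add_mul_ediv_left _ _ hp.ne'] at h2
    omega
  · have h1 : (y - 1) / 3 ^ j ≤ y / 3 ^ j := Int.ediv_le_ediv hp (by omega)
    have h2 : (y + 3 ^ j * (-1)) / 3 ^ j ≤ (y - 1) / 3 ^ j := Int.ediv_le_ediv hp (by omega)
    rw [Int.add_mul_ediv_left _ _ hp.ne'] at h2
    omega

lemma D_nb {j : ℕ} {b : ℤ} (hb : b % 3 = 1) {z q : Pt} (hz : z ∈ DReg j b) (hq : q ∈ HFractal)
    (hq1 : q.1 < 2 * 3 ^ j) (h : Nb z q) : q ∈ DReg j b ∨ q = ctr j b := by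
  obtain ⟨x, y⟩ := z
  obtain ⟨x', y'⟩ := q
  obtain ⟨hzH, hz1, hz2, hz3⟩ := hz
  simp only [Nb, Prod.mk.injEq] at *
  have hg := H_good hq
  have hr := rep_top j
  have hrn := rep_nonneg j
  have hp := p3 j
  have hv : (x' = x ∧ (y' = y + 1 ∨ y' = y - 1)) → (x', y') ∈ DReg j b ∨ (x', y') = ctr j b := by
    rintro ⟨rfl, hy⟩
    left
    refine ⟨hq, hz1, hz2, ?_⟩
    have hd : dg x' j = 1 := by
      unfold dg
      rw [show x' = 3 ^ j * 1 + (x' - 3 ^ j) by ring, div_split _ _ _ (by omega) (by omega)]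
      rfl
    have h2 := hg.2.2 j hd
    unfold dg at h2
    have h3 := near_div y y' j hy
    simp only [] at *
    omega
  rcases h with ⟨h1, h2⟩ | ⟨h1, h2⟩ | ⟨h1, h2⟩ | ⟨h1, h2⟩
  · left
    exact ⟨hq, by simp only []; omega, by simp only []; omega, by simp only []; rw [h2]; exact hz3⟩
  · by_cases h3 : rep (j + 1) < x'
    · left
      exact ⟨hq, h3, by simp only []; omega, by simp only []; rw [h2]; exact hz3⟩
    · right
      have h4 : x' = rep (j + 1) := by omega
      subst h4 h2
      have h5 : ∀ i < j, dg y' i = 1 := by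
        intro i hi
        refine hg.2.2 i ?_
        have := digits_of_mod 0 (j + 1) i (by omega)
        simpa using this
      have h6 := mod_of_digits y' j h5
      rw [hz3] at h6
      simp only [ctr, Prod.mk.injEq, true_and]
      exact h6
  · exact hv ⟨h1, Or.inl h2⟩
  · exact hv ⟨h1, Or.inr h2⟩

/-- Shifting a point of a large right half into the zone left of column `2·3^j` puts it
into the small right half. -/
lemma D_shift {j e : ℕ} {b b' : ℤ} {z : Pt} (hz : z ∈ DReg (j + e) b') {w : Pt}
    (hw : w ∈ HFractal) (hw1 : w.1 = z.1 - 3 ^ (j + 1) * rep e)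
    (hw2 : w.2 = z.2 + ((3 ^ j * b + rep j) - (3 ^ (j + e) * b' + rep (j + e))))
    (hlt : w.1 < 2 * 3 ^ j) : w ∈ DReg j b := by
  obtain ⟨hzH, hz1, hz2, hz3⟩ := hz
  have hr := rep_top j
  have hrn := rep_nonneg j
  have hp := p3 j
  have hs := rep_split (j + 1) e
  rw [show j + e + 1 = j + 1 + e by ring] at hz1
  have hx : z.1 / 3 ^ j = 3 * rep e + 1 := by
    have : z.1 = 3 ^ j * (3 * rep e + 1) + (w.1 - 3 ^ j) := by rw [hw1]; ring
    rw [this, div_split _ _ _ (by omega) (by omega)]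
  have hdig : ∀ i < e, dg (z.2 / 3 ^ j) i = 1 := by
    intro i hi
    have h1 : dg z.1 (j + i) = 1 := by
      have := digits_of_mod 0 (e + 1) i (by omega)
      rw [mul_zero, zero_add, rep, ← hx] at this
      unfold dg at this ⊢
      rw [pow_add, ← Int.ediv_ediv_of_nonneg (p3 j).le]
      exact this
    have h2 := (H_good hzH).2.2 _ h1
    unfold dg at h2 ⊢
    rw [pow_add, ← Int.ediv_ediv_of_nonneg (p3 j).le] at h2
    exact h2
  have h3 := mod_of_digits _ _ hdig
  rw [Int.ediv_ediv_of_nonneg (p3 j).le, ← pow_add, hz3] at h3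
  refine ⟨hw, by omega, by omega, ?_⟩
  have h4 : w.2 = z.2 + 3 ^ j * (b - 3 ^ e * b' - rep e) := by
    rw [hw2, rep_split j e, pow_add]; ring
  rw [h4, Int.add_mul_ediv_left _ _ hp.ne', h3]
  ring

/-! Assemblies. -/

lemma attach_nb {s : ℕ → ℕ} {α : Assembly} {p : Pt} {t : TileType}
    (h : 0 < attachStrength s α p t) : ∃ q, Nb p q ∧ α q ≠ none := by
  by_contra hcon
  push Not at hcon
  have h1 := hcon (p.1 + 1, p.2) (Or.inl rfl)
  have h2 := hcon (p.1 - 1, p.2) (Or.inr (Or.inl rfl))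
  have h3 := hcon (p.1, p.2 + 1) (Or.inr (Or.inr (Or.inl rfl)))
  have h4 := hcon (p.1, p.2 - 1) (Or.inr (Or.inr (Or.inr rfl)))
  simp [attachStrength, h1, h2, h3, h4] at h

lemma attach_mono {s : ℕ → ℕ} {α β : Assembly} {p v : Pt} {t : TileType}
    (h : ∀ q, Nb p q → ∀ t', α q = some t' → β (q + v) = some t') :
    attachStrength s α p t ≤ attachStrength s β (p + v) t := by
  have key : ∀ (q q' : Pt) (f : TileType → ℕ), Nb p q → q' = q + v →
      (match α q with | some t' => f t' | none => 0) ≤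
      (match β q' with | some t' => f t' | none => 0) := by
    intro q q' f hq hq'
    subst hq'
    cases hα : α q with
    | none => simp
    | some t' => rw [h q hq t' hα]
  unfold attachStrength
  refine Nat.add_le_add (Nat.add_le_add (Nat.add_le_add ?_ ?_) ?_) ?_
  · exact key (p.1 + 1, p.2) _ (fun t' => if t.east = t'.west then s t.east else 0) (Or.inl rfl)
      (by ext <;> simp; ring)
  · exact key (p.1 - 1, p.2) _ (fun t' => if t.west = t'.east then s t.west else 0)
      (Or.inr (Or.inl rfl)) (by ext <;> simp; ring)
  · exact key (p.1, p.2 + 1) _ (fun t' => if t.north = t'.south then s t.north else 0)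
      (Or.inr (Or.inr (Or.inl rfl))) (by ext <;> simp; ring)
  · exact key (p.1, p.2 - 1) _ (fun t' => if t.south = t'.north then s t.south else 0)
      (Or.inr (Or.inr (Or.inr rfl))) (by ext <;> simp; ring)

/-- A (stuttering) assembly sequence. -/
def Chain (S : TAS) (c : ℕ → Assembly) : Prop :=
  ∀ n, c (n + 1) = c n ∨ Step S (c n) (c (n + 1))

lemma step_some {S : TAS} {α β : Assembly} (h : Step S α β) {p : Pt} {t : TileType}
    (hp : α p = some t) : β p = some t := by
  obtain ⟨q, t', -, hq, -, rfl⟩ := h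
  have : p ≠ q := by rintro rfl; simp [hp] at hq
  simp [this, hp]

lemma chain_mono {S : TAS} {c : ℕ → Assembly} (hc : Chain S c) {p : Pt} {t : TileType} {n k : ℕ}
    (hnk : n ≤ k) (h : c n p = some t) : c k p = some t := by
  induction k, hnk using Nat.le_induction with
  | base => exact h
  | succ k _ ih =>
    rcases hc k with h1 | h1
    · rw [h1]; exact ih
    · exact step_some h1 ih

lemma chain_ne {S : TAS} {c : ℕ → Assembly} (hc : Chain S c) {p : Pt} {n k : ℕ}
    (hnk : n ≤ k) (h : c n p ≠ none) : c k p ≠ none := by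
  obtain ⟨t, ht⟩ := Option.ne_none_iff_exists'.1 h
  rw [chain_mono hc hnk ht]; simp

lemma chain_rtg {S : TAS} {c : ℕ → Assembly} (hc : Chain S c) (n : ℕ) :
    Relation.ReflTransGen (Step S) (c 0) (c n) := by
  induction n with
  | zero => exact .refl
  | succ n ih =>
    rcases hc n with h | h
    · rw [h]; exact ih
    · exact ih.tail h

lemma chain_tiles {S : TAS} {c : ℕ → Assembly} (hc : Chain S c) (h0 : c 0 = S.seed) (n : ℕ)
    {p : Pt} {t : TileType} (h : c n p = some t) : t ∈ S.tiles := by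
  induction n with
  | zero => exact S.seed_tiles p t (h0 ▸ h)
  | succ n ih =>
    rcases hc n with h1 | ⟨q, t', ht', -, -, h1⟩
    · exact ih (h1 ▸ h)
    · rw [h1] at h
      by_cases hp : p = q
      · subst hp
        simp at h
        exact h ▸ ht'
      · simp [hp] at h
        exact ih h

lemma reach_prepend {S : TAS} {a b α : Assembly} (h : Step S a b) (hr : ReachesFrom S b α) :
    ReachesFrom S a α := by
  obtain ⟨c, h0, hc, h1, h2⟩ := hr
  refine ⟨fun n => Nat.casesOn n a c, rfl, ?_, ?_, ?_⟩
  · intro n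
    cases n with
    | zero => right; simpa [h0] using h
    | succ n => exact hc n
  · intro p n t hn
    cases n with
    | zero => exact h1 p 0 t (by rw [h0]; exact step_some h hn)
    | succ n => exact h1 p n t hn
  · intro p t hp
    obtain ⟨n, hn⟩ := h2 p t hp
    exact ⟨n + 1, hn⟩

open Classical in
/-- try to attach a tile at position `p`. -/
noncomputable def tryAt (S : TAS) (α : Assembly) (p : Pt) : Assembly :=
  if h : ∃ t, t ∈ S.tiles ∧ α p = none ∧ S.temp ≤ attachStrength S.strength α p t then
    Function.update α p (some h.choose) else α

lemma tryAt_step (S : TAS) (α : Assembly) (p : Pt) :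
    tryAt S α p = α ∨ Step S α (tryAt S α p) := by
  unfold tryAt
  split_ifs with h
  · right
    exact ⟨p, h.choose, h.choose_spec.1, h.choose_spec.2.1, h.choose_spec.2.2, rfl⟩
  · left; rfl

lemma tryAt_fill (S : TAS) (α : Assembly) (p : Pt)
    (h : ∃ t, t ∈ S.tiles ∧ α p = none ∧ S.temp ≤ attachStrength S.strength α p t) :
    tryAt S α p p ≠ none := by
  unfold tryAt
  rw [dif_pos h]
  simp

/-- a fair sequence -/
noncomputable def fair (S : TAS) (β : Assembly) : ℕ → Assembly
  | 0 => β
  | n + 1 => tryAt S (fair S β n) ((Denumerable.eqv Pt).symm n.unpair.1)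

lemma exists_terminal (S : TAS) (β : Assembly) :
    ∃ α, ReachesFrom S β α ∧ Terminal S α := by
  classical
  have hc : Chain S (fair S β) := fun n => tryAt_step S _ _
  let α : Assembly := fun p => if h : ∃ n, fair S β n p ≠ none then fair S β h.choose p else none
  have hα1 : ∀ p n t, fair S β n p = some t → α p = some t := by
    intro p n t hn
    have h : ∃ n, fair S β n p ≠ none := ⟨n, by simp [hn]⟩
    simp only [α, dif_pos h]
    obtain ⟨t', ht'⟩ := Option.ne_none_iff_exists'.1 h.choose_spec
    have h1 := chain_mono hc (le_max_left n h.choose) hn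
    have h2 := chain_mono hc (le_max_right n h.choose) ht'
    rw [ht', ← h1, h2]
  have hα2 : ∀ p t, α p = some t → ∃ n, fair S β n p = some t := by
    intro p t hp
    by_cases h : ∃ n, fair S β n p ≠ none
    · simp only [α, dif_pos h] at hp
      exact ⟨_, hp⟩
    · simp only [α, dif_neg h] at hp
      simp at hp
  refine ⟨α, ⟨fair S β, rfl, hc, hα1, hα2⟩, ?_⟩
  rintro γ ⟨p, t, ht, hp, hs, -⟩
  have hq : ∀ q : Pt, ∃ n, ∀ t', α q = some t' → fair S β n q = some t' := by
    intro q
    cases h : α q with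
    | none => exact ⟨0, by simp⟩
    | some t' =>
      obtain ⟨n, hn⟩ := hα2 q t' h
      exact ⟨n, by rintro _ ⟨⟩; exact hn⟩
  choose k hk using hq
  let K := max (max (k (p.1 + 1, p.2)) (k (p.1 - 1, p.2))) (max (k (p.1, p.2 + 1)) (k (p.1, p.2 - 1)))
  let n := Nat.pair (Denumerable.eqv Pt p) K
  have hKn : K ≤ n := Nat.right_le_pair _ _
  have hK1 : ∀ q, Nb p q → k q ≤ K := by
    rintro q (rfl | rfl | rfl | rfl) <;> simp [K]
  have hnone : ∀ n, fair S β n p = none := by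
    intro n
    by_contra h
    obtain ⟨t', ht'⟩ := Option.ne_none_iff_exists'.1 h
    rw [hα1 p n t' ht'] at hp
    simp at hp
  have hstr : S.temp ≤ attachStrength S.strength (fair S β n) p t := by
    refine hs.trans ?_
    have := attach_mono (s := S.strength) (α := α) (β := fair S β n) (p := p) (v := 0) (t := t) (by
      intro q hq t' ht'
      rw [add_zero]
      exact chain_mono hc ((hK1 q hq).trans hKn) (hk q t' ht'))
    simpa using this
  have h1 := tryAt_fill S (fair S β n) p ⟨t, ht, hnone n, hstr⟩
  have h2 : fair S β (n + 1) = tryAt S (fair S β n) p := by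
    simp [fair, n]
  exact h1 (h2 ▸ hnone (n + 1))

lemma fin_sub {S : TAS} (hS : StrictlySelfAssembles S HFractal) {β : Assembly}
    (h : Relation.ReflTransGen (Step S) S.seed β) {z : Pt} (hz : β z ≠ none) : z ∈ HFractal := by
  obtain ⟨α, hr, ht⟩ := exists_terminal S β
  have h1' : ∀ a, Relation.ReflTransGen (Step S) a β → ReachesFrom S a α := by
    intro a h
    induction h using Relation.ReflTransGen.head_induction_on with
    | refl => exact hr
    | head h _ ih => exact reach_prepend h ih
  have h1 := h1' _ h
  have h2 := hS α h1 ht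
  rw [← h2]
  obtain ⟨c, h0, hc, h3, -⟩ := hr
  obtain ⟨t, hz⟩ := Option.ne_none_iff_exists'.1 hz
  have := h3 z 0 t (by rw [h0]; exact hz)
  simp [adom, this]

/-! The first arrival at column `2·3^j`. -/

lemma ctr_not_mem (j : ℕ) (b : ℤ) : ctr j b ∉ DReg j b := by
  rintro ⟨-, h, -⟩
  simp [ctr] at h

lemma chain_new {S : TAS} {c : ℕ → Assembly} (hc : Chain S c) {n : ℕ} {z : Pt}
    (h : c (n + 1) z ≠ none) (h0 : c n z = none) :
    ∃ t ∈ S.tiles, S.temp ≤ attachStrength S.strength (c n) z t ∧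
      c (n + 1) = Function.update (c n) z (some t) := by
  rcases hc n with h2 | ⟨p, t, ht, hp, hs, h2⟩
  · rw [h2] at h; exact absurd h0 h
  · by_cases hz : z = p
    · subst hz
      exact ⟨t, ht, hs, h2⟩
    · rw [h2] at h
      simp [hz] at h
      exact absurd h0 h

lemma chain_new_nb {S : TAS} {c : ℕ → Assembly} (hc : Chain S c) (h1 : 1 ≤ S.temp) {n : ℕ} {z : Pt}
    (h : c (n + 1) z ≠ none) (h0 : c n z = none) : ∃ q, Nb z q ∧ c n q ≠ none := by
  obtain ⟨t, -, hs, -⟩ := chain_new hc h h0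
  exact attach_nb (Nat.lt_of_lt_of_le h1 hs)

lemma stage {S : TAS} {c : ℕ → Assembly} (hc : Chain S c) (h1 : 1 ≤ S.temp)
    (hsub : ∀ n z, c n z ≠ none → z ∈ HFractal) (j : ℕ)
    (hseed : ∀ z, c 0 z ≠ none → z.1 < 3 ^ j)
    (hfar : ∃ n, ∃ z : Pt, c n z ≠ none ∧ 2 * 3 ^ j ≤ z.1) :
    ∃ (T : ℕ) (b : ℤ) (N : ℕ) (y : ℤ), 0 ≤ b ∧ b % 3 = 1 ∧
      (∀ n ≤ T, ∀ z, c n z ≠ none → z.1 < 2 * 3 ^ j) ∧ c (T + 1) (2 * 3 ^ j, y) ≠ none ∧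
      y / 3 ^ j = b ∧ N ≤ T ∧ c N (ctr j b) = c T (ctr j b) ∧ ∀ z ∈ DReg j b, c N z = none := by
  classical
  have hp := p3 j
  have hr := rep_top j
  have hrn := rep_nonneg j
  obtain ⟨T, hT⟩ : ∃ T, Nat.find hfar = T + 1 := by
    refine Nat.exists_eq_succ_of_ne_zero ?_
    intro h
    obtain ⟨z, hz, hz1⟩ := h ▸ Nat.find_spec hfar
    have := hseed z hz
    omega
  have hlt : ∀ n ≤ T, ∀ z, c n z ≠ none → z.1 < 2 * 3 ^ j := by
    intro n hn z hz
    by_contra h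
    exact Nat.find_min hfar (m := n) (by omega) ⟨z, hz, by omega⟩
  obtain ⟨⟨x, y⟩, hz, hz1⟩ := hT ▸ Nat.find_spec hfar
  simp only [] at hz1
  have hz0 : c T (x, y) = none := by
    by_contra h
    have := hlt T le_rfl _ h
    simp only [] at this
    omega
  obtain ⟨⟨x', y'⟩, hnb, hq⟩ := chain_new_nb hc h1 hz hz0
  have hq1 := hlt T le_rfl _ hq
  simp only [Nb, Prod.mk.injEq] at hnb hq1
  have hx : x' = 2 * 3 ^ j - 1 ∧ x = 2 * 3 ^ j ∧ y' = y := by omega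
  obtain ⟨rfl, rfl, rfl⟩ := hx
  have hg := H_good (hsub _ _ hq)
  have hd : dg (2 * 3 ^ j - 1) j = 1 := by
    unfold dg
    rw [show (2 * 3 ^ j - 1 : ℤ) = 3 ^ j * 1 + (3 ^ j - 1) by ring,
      div_split _ _ _ (by omega) (by omega)]
    rfl
  have hb := hg.2.2 j hd
  have hy0 := hg.2.1
  simp only [dg] at hb hy0
  set b := y' / 3 ^ j with hbdef
  have hb0 : 0 ≤ b := Int.ediv_nonneg hy0 hp.le
  have inv : ∀ n ≤ T, c n (ctr j b) = none → ∀ z ∈ DReg j b, c n z = none := by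
    intro n
    induction n with
    | zero =>
      intro _ _ z hz
      by_contra h
      have h2 := hseed z h
      have h3 := hz.2.1
      omega
    | succ n ih =>
      intro hn hctr z hz
      by_contra h
      have hctr' : c n (ctr j b) = none := by
        by_contra h'
        exact chain_ne hc (Nat.le_succ n) h' hctr
      have ih' := ih (by omega) hctr'
      obtain ⟨q, hnb, hq⟩ := chain_new_nb hc h1 h (ih' z hz)
      rcases D_nb hb hz (hsub _ _ hq) (hlt n (by omega) _ hq) hnb with h2 | h2
      · exact hq (ih' q h2)
      · exact hq (h2 ▸ hctr')
  by_cases hcT : c T (ctr j b) = none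
  · exact ⟨T, b, T, y', hb0, hb, hlt, hz, rfl, le_rfl, rfl, inv T le_rfl hcT⟩
  · have hex : ∃ n, c n (ctr j b) ≠ none := ⟨T, hcT⟩
    obtain ⟨N, hN⟩ : ∃ N, Nat.find hex = N + 1 := by
      refine Nat.exists_eq_succ_of_ne_zero ?_
      intro h
      have := hseed _ (h ▸ Nat.find_spec hex)
      simp only [ctr] at this
      omega
    have hNT : N + 1 ≤ T := hN ▸ Nat.find_min' hex hcT
    have hs := hN ▸ Nat.find_spec hex
    have hN0 : c N (ctr j b) = none := by
      by_contra h
      exact Nat.find_min hex (m := N) (by omega) h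
    refine ⟨T, b, N + 1, y', hb0, hb, hlt, hz, rfl, hNT, ?_, ?_⟩
    · obtain ⟨t, ht⟩ := Option.ne_none_iff_exists'.1 hs
      rw [ht, chain_mono hc hNT ht]
    · intro z hz
      obtain ⟨t, -, -, h2⟩ := chain_new hc hs hN0
      have hne : z ≠ ctr j b := by
        rintro rfl
        exact ctr_not_mem _ _ hz
      rw [h2]
      simp only [Function.update_of_ne hne]
      exact inv N (by omega) hN0 z hz

/-! Transplanting growth. -/

open Classical in
/-- The assembly `B` together with the part of `α` in `D`, shifted by `v`. -/
noncomputable def graft (B α : Assembly) (D : Set Pt) (v : Pt) : Assembly :=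
  fun w => if w - v ∈ D ∧ α (w - v) ≠ none then α (w - v) else B w

lemma graft_mem {B α : Assembly} {D : Set Pt} {v z : Pt} (hz : z ∈ D) (h : α z ≠ none) :
    graft B α D v (z + v) = α z := by
  simp [graft, hz, h]

lemma graft_congr {B α β : Assembly} {D : Set Pt} {v w : Pt} (h : α (w - v) = β (w - v)) :
    graft B α D v w = graft B β D v w := by
  by_cases h1 : w - v ∈ D ∧ β (w - v) ≠ none
  · unfold graft
    rw [if_pos h1, if_pos (by rw [h]; exact h1), h]
  · unfold graft
    rw [if_neg h1, if_neg (by rw [h]; exact h1)]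

lemma transplant {S : TAS} {c : ℕ → Assembly} (hc : Chain S c) (D : Set Pt) (c0 : Pt) (v : Pt)
    (B : Assembly) (K : ℕ) (hc0 : c0 ∉ D) (h0 : ∀ z ∈ D, c 0 z = none)
    (hnb : ∀ n < K, ∀ z ∈ D, ∀ w, Nb z w → c n w ≠ none → w ∈ D ∨ w = c0)
    (hB0 : ∀ n < K, ∀ t, c n c0 = some t → B (c0 + v) = some t)
    (hB : ∀ z ∈ D, B (z + v) = none) :
    ∀ n ≤ K, Relation.ReflTransGen (Step S) B (graft B (c n) D v) := by
  intro n
  induction n with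
  | zero =>
    intro _
    have : graft B (c 0) D v = B := by
      funext w
      simp only [graft]
      split_ifs with h
      · exact absurd (h0 _ h.1) h.2
      · rfl
    rw [this]
  | succ n ih =>
    intro hn
    have ih := ih (by omega)
    rcases hc n with h2 | ⟨p, t, ht, hp, hs, h2⟩
    · rw [h2]; exact ih
    · by_cases hpD : p ∈ D
      · refine ih.tail ⟨p + v, t, ht, ?_, ?_, ?_⟩
        · simp [graft, hp, hB p hpD]
        · refine hs.trans (attach_mono ?_)
          intro q hq t' ht'
          have hne : c n q ≠ none := by simp [ht']
          rcases hnb n (by omega) p hpD q hq hne with h3 | h3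
          · rw [graft_mem h3 hne, ht']
          · subst h3
            simp [graft, hc0]
            exact hB0 n (by omega) t' ht'
        · funext w
          by_cases hw : w = p + v
          · subst hw
            simp [graft, h2, hpD]
          · have hw' : w - v ≠ p := by
              rintro rfl
              simp at hw
            have h3 : c (n + 1) (w - v) = c n (w - v) := by rw [h2, Function.update_of_ne hw']
            rw [Function.update_of_ne hw]
            exact graft_congr h3
      · have : graft B (c (n + 1)) D v = graft B (c n) D v := by
          funext w
          by_cases hw : w - v = p
          · simp [graft, hw, hpD]
          · have h3 : c (n + 1) (w - v) = c n (w - v) := by rw [h2, Function.update_of_ne hw]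
            exact graft_congr h3
        rw [this]; exact ih

/-- Two scales that agree on the tile at the centre lead to a contradiction. -/
lemma clash {S : TAS} (hS : StrictlySelfAssembles S HFractal) {c : ℕ → Assembly} (hc : Chain S c)
    (hseed : c 0 = S.seed) (h1 : 1 ≤ S.temp)
    {j m e : ℕ} {b b' κ : ℤ} {N T' : ℕ} {y' : ℤ} (he : m + 3 ≤ e) (hκ : κ % 3 ≠ 0)
    (hb' : b' % 3 = 1)
    (hC : (3 ^ j * b + rep j) - (3 ^ (j + e) * b' + rep (j + e)) = 3 ^ (j + 1 + m) * κ)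
    (hx0 : ∀ z, c 0 z ≠ none → z.1 < 3 ^ j)
    (hN : ∀ z, c N z ≠ none → z.1 < 2 * 3 ^ j)
    (hND : ∀ z ∈ DReg j b, c N z = none)
    (hT : ∀ n ≤ T', ∀ z, c n z ≠ none → z.1 < 2 * 3 ^ (j + e))
    (hy : c (T' + 1) (2 * 3 ^ (j + e), y') ≠ none) (hy' : y' / 3 ^ (j + e) = b')
    (heq : c N (ctr j b) = c T' (ctr (j + e) b')) : False := by
  have hsub : ∀ n z, c n z ≠ none → z ∈ HFractal := fun n z h =>
    fin_sub hS (hseed ▸ chain_rtg hc n) h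
  set v : Pt := (-(3 ^ (j + 1) * rep e), 3 ^ (j + 1 + m) * κ) with hv
  have hvz : ∀ z : Pt, z + v = (z.1 - 3 ^ (j + 1) * rep e, z.2 + 3 ^ (j + 1 + m) * κ) := by
    intro z
    ext
    · simp [hv]; ring
    · simp [hv]
  have hctr : ctr (j + e) b' + v = ctr j b := by
    rw [hvz, ← hC]
    have := rep_split (j + 1) e
    simp only [ctr, show j + e + 1 = j + 1 + e by ring, this]
    ext <;> simp
  have htr := transplant hc (DReg (j + e) b') (ctr (j + e) b') v (c N) (T' + 1)
    (ctr_not_mem _ _)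
    (by
      intro z hz
      by_contra h
      have h2 := hx0 z h
      have h3 := hz.2.1
      have h4 := rep_top (j + e)
      have h5 := rep_nonneg (j + e)
      have h6 : (3 : ℤ) ^ j ≤ 3 ^ (j + e) := pow_le_pow_right₀ (by norm_num) (by omega)
      omega)
    (by
      intro n hn z hz w hw hne
      exact D_nb hb' hz (hsub _ _ hne) (hT n (by omega) _ hne) hw)
    (by
      intro n hn t ht
      rw [hctr, heq]
      exact chain_mono hc (by omega) ht)
    (by
      intro z hz
      by_contra h
      refine h (hND _ (D_shift hz (hsub _ _ h) ?_ ?_ (hN _ h)))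
      · rw [hvz]
      · rw [hvz, hC])
  have key : ∀ n ≤ T' + 1, ∀ z ∈ DReg (j + e) b', c n z ≠ none →
      Both j m e κ z ∧ KReg j m e κ z := by
    have hboth : ∀ n ≤ T' + 1, ∀ z ∈ DReg (j + e) b', c n z ≠ none → Both j m e κ z := by
      intro n hn z hz hne
      refine ⟨H_good hz.1, ?_⟩
      rw [← hvz]
      refine H_good (fin_sub hS ((hseed ▸ chain_rtg hc N).trans (htr n hn)) ?_)
      rw [graft_mem hz hne]
      exact hne
    intro n
    induction n with
    | zero =>
      intro _ z hz h
      exfalso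
      have h2 := hx0 z h
      have h3 := hz.2.1
      have h4 := rep_top (j + e)
      have h5 := rep_nonneg (j + e)
      have h6 : (3 : ℤ) ^ j ≤ 3 ^ (j + e) := pow_le_pow_right₀ (by norm_num) (by omega)
      omega
    | succ n ih =>
      intro hn z hz hne
      by_cases h0 : c n z = none
      · have hbz := hboth _ hn z hz hne
        refine ⟨hbz, ?_⟩
        obtain ⟨q, hnb, hq⟩ := chain_new_nb hc h1 hne h0
        rcases D_nb hb' hz (hsub _ _ hq) (hT n (by omega) _ hq) hnb with h2 | h2
        · obtain ⟨h3, h4⟩ := ih (by omega) q h2 hq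
          exact K_step he hκ hbz h3 h4 hnb
        · have h3 : Both j m e κ q := by
            refine ⟨H_good (hsub _ _ hq), ?_⟩
            rw [← hvz, h2, hctr]
            refine H_good (hsub N _ ?_)
            rw [heq, ← h2]
            exact chain_ne hc (by omega) hq
          refine K_step he hκ hbz h3 (K_start ?_ ?_) hnb
          · rw [h2]; simp only [ctr]; congr 1; ring
          · rw [h2]; exact ctr_digits _ _ hb' _ (by omega)
      · exact ih (by omega) z hz h0
  refine K_far (j := j) (m := m) (κ := κ) (z := (2 * 3 ^ (j + e), y')) he rfl
    (key (T' + 1) le_rfl _ ⟨hsub _ _ hy, ?_, le_rfl, hy'⟩ hy).2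
  have h4 := rep_top (j + e)
  have h5 := rep_lt (j + e)
  simp only []
  omega

/-- No aTAM tile assembly system strictly self-assembles the
H fractal `𝐇`. -/
theorem hFractal_not_strictlySelfAssembles :
    ∀ S : TAS, ¬ StrictlySelfAssembles S HFractal := by
  classical
  intro S hS
  obtain ⟨α, hr, ht⟩ := exists_terminal S S.seed
  have hα := hS α hr ht
  obtain ⟨c, hc0, hc, -, hα2⟩ := hr
  replace hc : Chain S c := hc
  have hsub : ∀ n z, c n z ≠ none → z ∈ HFractal := fun n z h =>
    fin_sub hS (hc0 ▸ chain_rtg hc n) h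
  have hcov : ∀ z ∈ HFractal, ∃ n, c n z ≠ none := by
    intro z hz
    rw [← hα] at hz
    obtain ⟨t, ht⟩ := Option.ne_none_iff_exists'.1 hz
    obtain ⟨n, hn⟩ := hα2 z t ht
    exact ⟨n, by simp [hn]⟩
  have h1 : 1 ≤ S.temp := by
    by_contra htemp
    obtain ⟨n, hn⟩ := hcov _ (far_mem 0)
    obtain ⟨t, hn⟩ := Option.ne_none_iff_exists'.1 hn
    have htm := chain_tiles hc hc0 n hn
    have hneg : ((-1, 0) : Pt) ∉ HFractal := by
      intro h
      have := (H_good h).1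
      simp at this
    have hs : S.seed (-1, 0) = none := by
      by_contra h
      exact hneg (hsub 0 _ (hc0 ▸ h))
    refine hneg (fin_sub hS (β := Function.update S.seed (-1, 0) (some t))
      (.single ⟨(-1, 0), t, htm, hs, by omega, rfl⟩) (by simp))
  obtain ⟨j0, hj0, hj⟩ : ∃ j0, 1 ≤ j0 ∧ ∀ z, c 0 z ≠ none → z.1 < 3 ^ j0 := by
    obtain ⟨u, hu⟩ := (S.seed_finite.image Prod.fst).bddAbove
    refine ⟨u.toNat + 1, by omega, ?_⟩
    intro z hz
    have h2 : z.1 ≤ u := hu ⟨z, by simpa [adom, ← hc0] using hz, rfl⟩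
    have h3 : u.toNat + 1 < 3 ^ (u.toNat + 1) := Nat.lt_pow_self (by norm_num)
    have h4 : ((u.toNat + 1 : ℕ) : ℤ) < 3 ^ (u.toNat + 1) := by exact_mod_cast h3
    omega
  have hji : ∀ i z, c 0 z ≠ none → z.1 < 3 ^ (j0 + i) := by
    intro i z hz
    have h6 : (3 : ℤ) ^ j0 ≤ 3 ^ (j0 + i) := pow_le_pow_right₀ (by norm_num) (by omega)
    exact (hj z hz).trans_le h6
  have hst := fun i => stage hc h1 hsub (j0 + i) (hji i) (by
    obtain ⟨n, hn⟩ := hcov _ (far_mem (j0 + i))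
    refine ⟨n, _, hn, ?_⟩
    have : (3 : ℤ) ^ (j0 + i) ≤ 3 ^ (j0 + i + 1) := pow_le_pow_right₀ (by norm_num) (by omega)
    simp only []
    omega)
  choose T b N y hb0 hb hT hy hyb hNT hNe hND using hst
  let f : ℕ → Option S.tiles := fun i =>
    match h : c (T i) (ctr (j0 + i) (b i)) with
    | none => none
    | some t => some ⟨t, chain_tiles hc hc0 _ h⟩
  have hf : ∀ i, c (T i) (ctr (j0 + i) (b i)) = (f i).map Subtype.val := by
    intro i
    simp only [f]
    split <;> simp_all
  obtain ⟨o, ho⟩ := Finite.exists_infinite_fiber f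
  rw [Set.infinite_coe_iff] at ho
  obtain ⟨i, hi⟩ := ho.nonempty
  have hex : ∃ M, dg (3 ^ (j0 + i) * b i + rep (j0 + i)) M ≠ 1 := by
    set C := 3 ^ (j0 + i) * b i + rep (j0 + i) with hC
    have hC0 : 0 ≤ C := by
      have := rep_nonneg (j0 + i)
      have := mul_nonneg (p3 (j0 + i)).le (hb0 i)
      omega
    refine ⟨C.toNat, ?_⟩
    have h3 : C.toNat < 3 ^ C.toNat := Nat.lt_pow_self (by norm_num)
    have h4 : ((C.toNat : ℕ) : ℤ) < 3 ^ C.toNat := by exact_mod_cast h3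
    unfold dg
    rw [Int.ediv_eq_zero_of_lt hC0 (by omega)]
    simp
  have hMj : j0 + i + 1 ≤ Nat.find hex := by
    by_contra h
    exact Nat.find_spec hex (ctr_digits _ _ (hb i) _ (by omega))
  obtain ⟨m, hm⟩ := Nat.exists_eq_add_of_le hMj
  have hM1 := Nat.find_spec hex
  have hM2 : ∀ k < Nat.find hex, dg (3 ^ (j0 + i) * b i + rep (j0 + i)) k = 1 := by
    intro k hk
    by_contra h
    exact Nat.find_min hex hk h
  rw [hm] at hM1 hM2
  obtain ⟨i', hi', hlt⟩ := ho.exists_gt (i + m + 3)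
  obtain ⟨e, rfl⟩ : ∃ e, i' = i + e := ⟨i' - i, by omega⟩
  have he : m + 3 ≤ e := by omega
  have hdig' : ∀ k ≤ j0 + (i + e), dg (3 ^ (j0 + (i + e)) * b (i + e) + rep (j0 + (i + e))) k = 1 :=
    fun k hk => ctr_digits _ _ (hb (i + e)) k hk
  have hm1 := mod_of_digits _ _ hM2
  have hm2 := mod_of_digits _ (j0 + i + 1 + m) (fun k hk => hdig' k (by omega))
  have hm3 := hdig' (j0 + i + 1 + m) (by omega)
  have hje : j0 + (i + e) = j0 + i + e := by ring
  have hT' := hT (i + e)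
  have hy' := hy (i + e)
  have hyb' := hyb (i + e)
  have hfe : c (N i) (ctr (j0 + i) (b i)) = c (T (i + e)) (ctr (j0 + (i + e)) (b (i + e))) := by
    rw [hNe, hf, hf, show f i = o from hi, show f (i + e) = o from hi']
  rw [hje] at hm2 hm3 hT' hy' hyb' hfe
  refine clash hS hc hc0 h1 (m := m) (b := b i) (N := N i)
    (κ := (3 ^ (j0 + i) * b i + rep (j0 + i)) / 3 ^ (j0 + i + 1 + m) -
      (3 ^ (j0 + i + e) * b (i + e) + rep (j0 + i + e)) / 3 ^ (j0 + i + 1 + m)) he ?_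
    (hb (i + e)) ?_ (hji i) (hT i _ (hNT i)) (hND i) hT' hy' hyb' hfe
  · unfold dg at hM1 hm3
    omega
  · linear_combination hm1 - hm2
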